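/- arXiv:1901.06425 — 2 statements merged into one kernel-verified Lean document; each statement's English description precedes it below -/
import Mathlib

section
/- The set {β(G) : G a finite abelian group} is dense in [0, ∞). -/
noncomputable def beta (G : Type*) [Group G] : ℝ :=
  (Nat.card (Subgroup G) : ℝ) / (Nat.card G : ℝ)

open Module Finset in
/-- Counting linearly independent `k`-tuples in `V` by the `k`-dimensional subspace they span. -/
theorem card_submodule_finrank_eq_mul {K V : Type*} [Field K] [Fintype K] [AddCommGroup V]
    [Module K V] [Finite V] {k : ℕ} (hk : k ≤ finrank K V) :
    Nat.card {W : Submodule K V // finrank K W = k} *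
        ∏ i : Fin k, (Fintype.card K ^ k - Fintype.card K ^ i.val) =
      ∏ i : Fin k, (Fintype.card K ^ finrank K V - Fintype.card K ^ i.val) := by
  classical
  rw [← card_linearIndependent hk]
  let span : {s : Fin k → V // LinearIndependent K s} →
      {W : Submodule K V // finrank K W = k} :=
    fun s => ⟨Submodule.span K (Set.range s.1), by
      simpa using finrank_span_eq_card s.2⟩
  have hfiber (W : {W : Submodule K V // finrank K W = k}) :
      Nat.card {s // span s = W} =
        ∏ i : Fin k, (Fintype.card K ^ k - Fintype.card K ^ i.val) := by
    have hW := card_linearIndependent (K := K) (V := W.1) (k := k) W.2.ge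
    rw [W.2] at hW
    rw [← hW]
    refine Nat.card_congr
      { toFun := fun s => ⟨fun i => ⟨s.1.1 i, ?_⟩, ?_⟩
        invFun := fun t => ⟨⟨fun i => (t.1 i : V), ?_⟩, ?_⟩
        left_inv := fun s => rfl
        right_inv := fun t => rfl }
    · have h : Submodule.span K (Set.range s.1.1) = W.1 := congrArg Subtype.val s.2
      rw [← h]
      exact Submodule.subset_span ⟨i, rfl⟩
    · exact LinearIndependent.of_comp W.1.subtype s.1.2
    · exact t.2.map' W.1.subtype W.1.ker_subtype
    · apply Subtype.ext
      refine Submodule.eq_of_le_of_finrank_eq ?_ ?_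
      · rw [Submodule.span_le]
        rintro _ ⟨i, rfl⟩
        exact (t.1 i).2
      · exact (span _).2.trans W.2.symm
  have := Fintype.ofFinite {W : Submodule K V // finrank K W = k}
  rw [← Nat.card_congr (Equiv.sigmaFiberEquiv span), Nat.card_sigma]
  simp [hfiber]

open Module in
theorem card_submodule_of_finrank_eq_four {K V : Type*} [Field K] [Fintype K] [AddCommGroup V]
    [Module K V] [Finite V] (hV : finrank K V = 4) :
    Nat.card (Submodule K V) = Fintype.card K ^ 4 + 3 * Fintype.card K ^ 3 +
      4 * Fintype.card K ^ 2 + 3 * Fintype.card K + 5 := by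
  classical
  have hq : 1 < Fintype.card K := Fintype.one_lt_card
  have key (k : ℕ) (hk : k ≤ 4) := card_submodule_finrank_eq_mul (K := K) (V := V) (hV ▸ hk)
  rw [hV] at key
  let dim : Submodule K V → Fin 5 := fun W =>
    ⟨finrank K W, by have := Submodule.finrank_le W; omega⟩
  have hdim (k : Fin 5) : Nat.card {W // dim W = k} =
      Nat.card {W : Submodule K V // finrank K W = k} :=
    Nat.card_congr (Equiv.subtypeEquivRight fun W => by simp [dim, Fin.ext_iff])
  rw [← Nat.card_congr (Equiv.sigmaFiberEquiv dim), Nat.card_sigma]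
  simp only [hdim, Fin.sum_univ_five]
  have cast_sub (a b : ℕ) (h : b ≤ a) : ((Fintype.card K ^ a - Fintype.card K ^ b : ℕ) : ℤ) =
      (Fintype.card K : ℤ) ^ a - (Fintype.card K : ℤ) ^ b := by
    rw [Nat.cast_sub (Nat.pow_le_pow_right hq.le h)]; push_cast; rfl
  have h1 := congrArg (Nat.cast : ℕ → ℤ) (key 1 (by omega))
  have h2 := congrArg (Nat.cast : ℕ → ℤ) (key 2 (by omega))
  have h3 := congrArg (Nat.cast : ℕ → ℤ) (key 3 (by omega))
  have h4 := congrArg (Nat.cast : ℕ → ℤ) (key 4 (by omega))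
  rw [Nat.cast_mul] at h1 h2 h3 h4
  norm_num only [Fin.prod_univ_succ, Nat.cast_mul, cast_sub, Fin.val_zero,
    Fin.val_succ, Finset.univ_eq_empty, Finset.prod_empty, Nat.cast_one] at h1 h2 h3 h4
  rw [← Nat.cast_inj (R := ℤ)]
  push_cast
  have hq' : (1 : ℤ) < Fintype.card K := by exact_mod_cast hq
  generalize (Fintype.card K : ℤ) = q at *
  have e0 : q ≠ 0 := by omega
  have e1 : q - 1 ≠ 0 := by omega
  have e2 : q + 1 ≠ 0 := by omega
  have e3 : q ^ 2 + q + 1 ≠ 0 := by positivity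
  have e4 : q ^ 2 + 1 ≠ 0 := by positivity
  have r1 : (Nat.card {W : Submodule K V // finrank K W = 1} : ℤ) = q ^ 3 + q ^ 2 + q + 1 := by
    apply mul_right_cancel₀ e1
    linear_combination h1
  have r2 : (Nat.card {W : Submodule K V // finrank K W = 2} : ℤ) =
      (q ^ 2 + 1) * (q ^ 2 + q + 1) := by
    apply mul_right_cancel₀ (mul_ne_zero (mul_ne_zero e0 (pow_ne_zero 2 e1)) e2)
    linear_combination h2
  have r3 : (Nat.card {W : Submodule K V // finrank K W = 3} : ℤ) = q ^ 3 + q ^ 2 + q + 1 := by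
    apply mul_right_cancel₀
      (mul_ne_zero (mul_ne_zero (mul_ne_zero (pow_ne_zero 3 e0) (pow_ne_zero 3 e1)) e2) e3)
    linear_combination h3
  have r4 : (Nat.card {W : Submodule K V // finrank K W = 4} : ℤ) = 1 := by
    apply mul_right_cancel₀ (mul_ne_zero (mul_ne_zero (mul_ne_zero (mul_ne_zero (pow_ne_zero 6 e0)
      (pow_ne_zero 4 e1)) (pow_ne_zero 2 e2)) e3) e4)
    linear_combination h4
  have r0 : (Nat.card {W : Submodule K V // finrank K W = 0} : ℤ) = 1 := by
    simp
  change (Nat.card {W : Submodule K V // finrank K W = 0} : ℤ) +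
    Nat.card {W : Submodule K V // finrank K W = 1} +
    Nat.card {W : Submodule K V // finrank K W = 2} +
    Nat.card {W : Submodule K V // finrank K W = 3} +
    Nat.card {W : Submodule K V // finrank K W = 4} = _
  rw [r0, r1, r2, r3, r4]
  ring

theorem beta_elementary_abelian_four (p : ℕ) [Fact p.Prime] :
    beta (Multiplicative (Fin 4 → ZMod p)) =
      1 + (3 / p + 4 / p ^ 2 + 3 / p ^ 3 + 5 / p ^ 4 : ℝ) := by
  have hp : (p : ℝ) ≠ 0 := by exact_mod_cast (Fact.out : p.Prime).ne_zero
  have h1 : Nat.card (Subgroup (Multiplicative (Fin 4 → ZMod p))) =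
      p ^ 4 + 3 * p ^ 3 + 4 * p ^ 2 + 3 * p + 5 := by
    rw [← Nat.card_congr AddSubgroup.toSubgroup.toEquiv,
      Nat.card_congr (AddSubgroup.toZModSubmodule p).toEquiv,
      card_submodule_of_finrank_eq_four (by simp), ZMod.card]
  have h2 : Nat.card (Multiplicative (Fin 4 → ZMod p)) = p ^ 4 := by
    simp [Nat.card_eq_fintype_card, ZMod.card]
  rw [beta, h1, h2]
  push_cast
  field_simp
  ring

theorem beta_of_prime_card {G : Type*} [Group G] {p : ℕ} (hp : p.Prime) (hG : Nat.card G = p) :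
    beta G = 2 / p := by
  classical
  have := Fact.mk hp
  have : Finite G := Nat.finite_of_card_ne_zero (hG ▸ hp.ne_zero)
  have : Nontrivial (Subgroup G) := by
    rw [Subgroup.nontrivial_iff]
    exact Finite.one_lt_card_iff_nontrivial.1 (hG ▸ hp.one_lt)
  have : IsSimpleOrder (Subgroup G) :=
    { eq_bot_or_eq_top := fun H =>
        have := Fact.mk (hG ▸ hp : (Nat.card G).Prime)
        H.eq_bot_or_eq_top_of_prime_card }
  rw [beta, hG, Nat.card_congr IsSimpleOrder.equivBool]
  simp

theorem Subgroup.card_prod_of_coprime {G H : Type*} [Group G] [Group H]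
    (h : (Nat.card G).Coprime (Nat.card H)) :
    Nat.card (Subgroup (G × H)) = Nat.card (Subgroup G) * Nat.card (Subgroup H) := by
  obtain ⟨m, hmG, hmH⟩ := Nat.chineseRemainder h 1 0
  obtain ⟨n, hnG, hnH⟩ := Nat.chineseRemainder h 0 1
  have hG1 (g : G) : g ^ m = g := by rw [← pow_mod_natCard, hmG, pow_mod_natCard, pow_one]
  have hH0 (g : H) : g ^ m = 1 := by rw [← pow_mod_natCard, hmH, pow_mod_natCard, pow_zero]
  have hG0 (g : G) : g ^ n = 1 := by rw [← pow_mod_natCard, hnG, pow_mod_natCard, pow_zero]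
  have hH1 (g : H) : g ^ n = g := by rw [← pow_mod_natCard, hnH, pow_mod_natCard, pow_one]
  rw [← Nat.card_prod]
  refine Nat.card_congr
    { toFun := fun K => (K.comap (MonoidHom.inl G H), K.comap (MonoidHom.inr G H))
      invFun := fun P => P.1.prod P.2
      left_inv := fun K => ?_
      right_inv := fun P => ?_ }
  · ext ⟨a, b⟩
    simp only [Subgroup.mem_prod, Subgroup.mem_comap, MonoidHom.inl_apply, MonoidHom.inr_apply]
    refine ⟨fun ⟨ha, hb⟩ => by simpa using K.mul_mem ha hb, fun hab => ⟨?_, ?_⟩⟩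
    · simpa [Prod.pow_mk, hG1, hH0] using K.pow_mem hab m
    · simpa [Prod.pow_mk, hG0, hH1] using K.pow_mem hab n
  · ext <;> simp [Subgroup.mem_prod, P.1.one_mem, P.2.one_mem]

theorem beta_prod_of_coprime {G H : Type*} [Group G] [Group H]
    (h : (Nat.card G).Coprime (Nat.card H)) : beta (G × H) = beta G * beta H := by
  simp only [beta, Subgroup.card_prod_of_coprime h, Nat.card_prod]
  push_cast
  exact (div_mul_div_comm _ _ _ _).symm

/-- `x` is the value of `beta` at some finite abelian group of order coprime to all primes
`p ≥ n`. -/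
def IsBetaBelow (n : ℕ) (x : ℝ) : Prop :=
  ∃ (G : Type) (_ : CommGroup G), Finite G ∧ (∀ p, p.Prime → p ∣ Nat.card G → p < n) ∧ beta G = x

theorem isBetaBelow_two_div_prime {q : ℕ} (hq : q.Prime) : IsBetaBelow (q + 1) (2 / q) := by
  have := Fact.mk hq
  have hcard : Nat.card (Multiplicative (ZMod q)) = q := by
    simp [Nat.card_eq_fintype_card, ZMod.card]
  refine ⟨Multiplicative (ZMod q), inferInstance, inferInstance, fun p _ hpq => ?_,
    beta_of_prime_card hq hcard⟩
  rw [hcard] at hpq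
  exact Nat.lt_succ_of_le (Nat.le_of_dvd hq.pos hpq)

/-- The factor contributed by the prime `p`, namely the value of `beta` at the elementary abelian
group of order `p ^ 4`; it is `1` when `p` is not prime. -/
noncomputable def primeFactor (p : ℕ) : ℝ :=
  if p.Prime then 1 + (3 / p + 4 / p ^ 2 + 3 / p ^ 3 + 5 / p ^ 4 : ℝ) else 1

theorem IsBetaBelow.mul_primeFactor {n : ℕ} {x : ℝ} (h : IsBetaBelow n x) :
    IsBetaBelow (n + 1) (x * primeFactor n) := by
  obtain ⟨G, _, _, hG, rfl⟩ := h
  by_cases hn : n.Prime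
  · have := Fact.mk hn
    have hcard : Nat.card (Multiplicative (Fin 4 → ZMod n)) = n ^ 4 := by
      simp [Nat.card_eq_fintype_card, ZMod.card]
    have hcop : (Nat.card G).Coprime (Nat.card (Multiplicative (Fin 4 → ZMod n))) := by
      rw [hcard]
      refine Nat.Coprime.pow_right _ (Nat.Coprime.symm ?_)
      exact (Nat.Prime.coprime_iff_not_dvd hn).2 fun hd => (hG n hn hd).false
    refine ⟨G × Multiplicative (Fin 4 → ZMod n), inferInstance, inferInstance, ?_, ?_⟩
    · intro p hp hd
      rw [Nat.card_prod, hcard, hp.dvd_mul] at hd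
      rcases hd with hd | hd
      · exact (hG p hp hd).trans n.lt_succ_self
      · exact Nat.lt_succ_of_le (Nat.le_of_dvd hn.pos (hp.dvd_of_dvd_pow hd))
    · rw [beta_prod_of_coprime hcop, beta_elementary_abelian_four, primeFactor, if_pos hn]
  · exact ⟨G, inferInstance, inferInstance, fun p hp hd => (hG p hp hd).trans n.lt_succ_self,
      by simp [primeFactor, hn]⟩

theorem IsBetaBelow.mul_prod_primeFactor {n : ℕ} {x : ℝ} (h : IsBetaBelow n x) (m : ℕ) :
    IsBetaBelow (n + m) (x * ∏ i ∈ Finset.range m, primeFactor (n + i)) := by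
  induction m with
  | zero => simpa using h
  | succ m ih =>
    rw [Finset.prod_range_succ, ← mul_assoc]
    exact ih.mul_primeFactor

theorem one_add_indicator_le_primeFactor (p : ℕ) :
    1 + Set.indicator {p | p.Prime} (fun n : ℕ => (1 : ℝ) / n) p ≤ primeFactor p := by
  by_cases hp : p.Prime
  · rw [primeFactor, if_pos hp, Set.indicator_of_mem (by exact hp)]
    have h : (1 : ℝ) / p ≤ 3 / p := by gcongr; norm_num
    have : (0 : ℝ) ≤ 4 / p ^ 2 + 3 / p ^ 3 + 5 / p ^ 4 := by positivity
    linarith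
  · rw [primeFactor, if_neg hp, Set.indicator_of_notMem (by exact hp), add_zero]

theorem primeFactor_le (p : ℕ) : primeFactor p ≤ 1 + 15 / p := by
  unfold primeFactor
  split_ifs with hp
  · have hp1 : (1 : ℝ) ≤ p := by exact_mod_cast hp.one_le
    have h (a : ℝ) (ha : 0 ≤ a) (k : ℕ) (hk : k ≠ 0) : a / (p : ℝ) ^ k ≤ a / p := by
      gcongr
      exact le_self_pow₀ hp1 hk
    have h2 := h 4 (by norm_num) 2 (by norm_num)
    have h3 := h 3 (by norm_num) 3 (by norm_num)
    have h4 := h 5 (by norm_num) 4 (by norm_num)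
    have : (15 : ℝ) / p = 3 / p + 4 / p + 3 / p + 5 / p := by ring
    linarith
  · have : (0 : ℝ) ≤ 15 / p := by positivity
    linarith

open Filter in
theorem tendsto_prod_primeFactor_atTop (n : ℕ) :
    Tendsto (fun m => ∏ i ∈ Finset.range m, primeFactor (n + i)) atTop atTop := by
  set f : ℕ → ℝ := Set.indicator {p | p.Prime} (fun n : ℕ => (1 : ℝ) / n)
  have hf0 (i : ℕ) : 0 ≤ f i := Set.indicator_nonneg (fun _ _ => by positivity) i
  have hns : ¬ Summable fun i => f (n + i) := by
    simp_rw [add_comm n]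
    rw [summable_nat_add_iff n]
    exact not_summable_one_div_on_primes
  have htend := (not_summable_iff_tendsto_nat_atTop_of_nonneg fun i => hf0 (n + i)).1 hns
  refine tendsto_atTop_mono (fun m => ?_) htend
  have hprod : 1 + ∑ i ∈ Finset.range m, f (n + i) ≤
      ∏ i ∈ Finset.range m, primeFactor (n + i) := by
    induction m with
    | zero => simp
    | succ m ih =>
      rw [Finset.prod_range_succ, Finset.sum_range_succ]
      have hs : 0 ≤ ∑ i ∈ Finset.range m, f (n + i) := Finset.sum_nonneg fun i _ => hf0 _
      have hm := hf0 (n + m)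
      calc 1 + (∑ i ∈ Finset.range m, f (n + i) + f (n + m))
          ≤ (1 + ∑ i ∈ Finset.range m, f (n + i)) * (1 + f (n + m)) := by nlinarith
        _ ≤ _ := mul_le_mul ih (one_add_indicator_le_primeFactor _) (by positivity)
            (by linarith)
  linarith

theorem exists_isBetaBelow_near {x ε : ℝ} (hx : 0 < x) (hε : 0 < ε) :
    ∃ n y, IsBetaBelow n y ∧ x < y ∧ y < x + ε := by
  obtain ⟨N, hN⟩ := exists_nat_gt (max (2 / x) (15 * x / ε))
  obtain ⟨q, hNq, hq⟩ := Nat.exists_infinite_primes N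
  have hNq' : (N : ℝ) ≤ q := by exact_mod_cast hNq
  have hq0 : (0 : ℝ) < q := by exact_mod_cast hq.pos
  have hqx : 2 / (q : ℝ) ≤ x := by
    have : 2 / x < q := (le_max_left _ _).trans_lt (hN.trans_le hNq')
    rw [div_lt_iff₀ hx] at this
    rw [div_le_iff₀ hq0]
    linarith
  have hqε : 15 * x / ε < q := (le_max_right _ _).trans_lt (hN.trans_le hNq')
  set P : ℕ → ℝ := fun m => 2 / (q : ℝ) * ∏ i ∈ Finset.range m, primeFactor (q + 1 + i) with hP
  have hex : ∃ m, x < P m :=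
    (((tendsto_prod_primeFactor_atTop (q + 1)).const_mul_atTop
      (by positivity : (0 : ℝ) < 2 / q)).eventually_gt_atTop x).exists
  classical
  obtain ⟨m, hm⟩ : ∃ m, Nat.find hex = m + 1 := by
    refine Nat.exists_eq_succ_of_ne_zero fun h0 => ?_
    have := Nat.find_spec hex
    rw [h0] at this
    simp only [hP, Finset.range_zero, Finset.prod_empty, mul_one] at this
    exact this.not_ge hqx
  have hgt : x < P (m + 1) := hm ▸ Nat.find_spec hex
  have hle : P m ≤ x := not_lt.1 (Nat.find_min hex (by omega))
  refine ⟨_, P (m + 1), (isBetaBelow_two_div_prime hq).mul_prod_primeFactor (m + 1), hgt, ?_⟩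
  have hstep : P (m + 1) = P m * primeFactor (q + 1 + m) := by
    simp only [hP, Finset.prod_range_succ, mul_assoc]
  have hfac : primeFactor (q + 1 + m) ≤ 1 + 15 / q := by
    refine (primeFactor_le _).trans ?_
    gcongr
    linarith [(Nat.cast_nonneg m : (0 : ℝ) ≤ m)]
  have hfac0 : 0 ≤ primeFactor (q + 1 + m) :=
    (add_nonneg zero_le_one (Set.indicator_nonneg (fun _ _ => by positivity) _)).trans
      (one_add_indicator_le_primeFactor _)
  calc P (m + 1) = P m * primeFactor (q + 1 + m) := hstep
    _ ≤ x * (1 + 15 / q) := mul_le_mul hle hfac hfac0 hx.le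
    _ = x + 15 * x / q := by ring
    _ < x + ε := by
      rw [div_lt_iff₀ hε] at hqε
      have : 15 * x / q < ε := by
        rw [div_lt_iff₀ hq0]
        linarith
      linarith

theorem stmt_13 :
    closure {x : ℝ | ∃ (G : Type) (inst : CommGroup G),
      Finite G ∧ @beta G inst.toGroup = x} = Set.Ici (0 : ℝ) := by
  apply Set.Subset.antisymm
  · refine closure_minimal ?_ isClosed_Ici
    rintro _ ⟨G, _, _, rfl⟩
    rw [Set.mem_Ici, beta]
    positivity
  · rw [← closure_Ioi (0 : ℝ)]
    refine closure_minimal (fun x hx => ?_) isClosed_closure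
    rw [Metric.mem_closure_iff]
    intro ε hε
    obtain ⟨n, y, ⟨G, inst, hfin, -, hG⟩, hxy, hyx⟩ := exists_isBetaBelow_near hx hε
    refine ⟨y, ⟨G, inst, hfin, hG⟩, ?_⟩
    rw [dist_comm, Real.dist_eq, abs_lt]
    constructor <;> linarith
end

section
/- Let p be a prime, n ≥ 3 an integer, and G an abelian p-group of rank 2 and order p^n, i.e., G ≅ Z_{p^{d_1}} × Z_{p^{d_2}} with 1 ≤ d_1 ≤ d_2 and d_1 + d_2 = n. Then β(G) ≤ 1, and equality holds if and only if G ≅ Z_2 × Z_4. -/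
/-- A subgroup of `A × B` whose first projection lies in `zpowers k` is determined by an element of
the form `(k, y)` and its intersection with `B`. -/
lemma Subgroup.le_of_mem_of_comap_inr_le {A B : Type*} [Group A] [Group B]
    {H₁ H₂ : Subgroup (A × B)} {k : A} {y : B}
    (hK : H₁.map (MonoidHom.fst A B) ≤ Subgroup.zpowers k)
    (hL : H₁.comap (MonoidHom.inr A B) ≤ H₂.comap (MonoidHom.inr A B))
    (h₁ : (k, y) ∈ H₁) (h₂ : (k, y) ∈ H₂) : H₁ ≤ H₂ := by
  rintro ⟨x, z⟩ hx
  obtain ⟨m, rfl⟩ := Subgroup.mem_zpowers_iff.1 (hK ⟨_, hx, rfl⟩)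
  have hz : (y ^ m)⁻¹ * z ∈ H₁.comap (MonoidHom.inr A B) := by
    have := H₁.mul_mem (H₁.inv_mem (H₁.zpow_mem h₁ m)) hx
    simpa using this
  have := H₂.mul_mem (H₂.zpow_mem h₂ m) (Subgroup.mem_comap.1 (hL hz))
  simpa using this

/-- The number of subgroups of `A × B` with given projection to `A` and given intersection
with `B`. -/
lemma Subgroup.card_map_fst_comap_inr_le {A B : Type*} [Group A] [CommGroup B]
    [IsCyclic A] [IsCyclic B] [Finite A] [Finite B] (K : Subgroup A) (L : Subgroup B) :
    Nat.card {H : Subgroup (A × B) //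
      (H.map (MonoidHom.fst A B), H.comap (MonoidHom.inr A B)) = (K, L)} ≤
      L.index.gcd (Nat.card K) := by
  obtain ⟨k, rfl⟩ := Subgroup.isCyclic_iff_exists_zpowers_eq_top K |>.1 inferInstance
  have hy : ∀ H : {H : Subgroup (A × B) // (H.map (MonoidHom.fst A B),
      H.comap (MonoidHom.inr A B)) = (Subgroup.zpowers k, L)}, ∃ y : B, (k, y) ∈ H.1 := by
    rintro ⟨H, hH⟩
    obtain ⟨hK, -⟩ := Prod.mk.inj hH
    obtain ⟨⟨x, y⟩, hxy, rfl⟩ := hK.ge (Subgroup.mem_zpowers k)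
    exact ⟨y, hxy⟩
  choose y hy using hy
  rw [Subgroup.index, ← IsCyclic.card_powMonoidHom_ker]
  refine Nat.card_le_card_of_injective (fun H ↦ ⟨(y H : B ⧸ L), ?_⟩) ?_
  · obtain ⟨-, hL⟩ := Prod.mk.inj H.2
    have := H.1.pow_mem (hy H) (orderOf k)
    rw [MonoidHom.mem_ker, powMonoidHom_apply, Nat.card_zpowers, ← QuotientGroup.mk_pow,
      QuotientGroup.eq_one_iff, ← hL]
    simpa [pow_orderOf_eq_one] using this
  · intro H₁ H₂ h
    obtain ⟨hK₁, hL₁⟩ := Prod.mk.inj H₁.2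
    obtain ⟨hK₂, hL₂⟩ := Prod.mk.inj H₂.2
    have hq : (y H₁)⁻¹ * y H₂ ∈ L := QuotientGroup.eq.1 (congrArg Subtype.val h)
    have h₂ : (k, y H₂) ∈ H₁.1 := by
      rw [← hL₁] at hq
      simpa using H₁.1.mul_mem (hy H₁) (Subgroup.mem_comap.1 hq)
    exact Subtype.ext (le_antisymm
      (Subgroup.le_of_mem_of_comap_inr_le hK₁.le (hL₁.trans hL₂.symm).le h₂ (hy H₂))
      (Subgroup.le_of_mem_of_comap_inr_le hK₂.le (hL₂.trans hL₁.symm).le (hy H₂) h₂))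

lemma IsCyclic.card_subgroup_injective {A : Type*} [CommGroup A] [IsCyclic A] [Finite A] :
    Function.Injective fun K : Subgroup A ↦ Nat.card K := by
  have key (K : Subgroup A) : K = (powMonoidHom (Nat.card K) : A →* A).ker := by
    refine Subgroup.eq_of_le_of_card_ge (fun x hx ↦ ?_) ?_
    · exact congrArg Subtype.val (pow_card_eq_one' (x := (⟨x, hx⟩ : K)))
    · rw [IsCyclic.card_powMonoidHom_ker, Nat.gcd_eq_right K.card_subgroup_dvd_card]
  intro K₁ K₂ h
  rw [key K₁, key K₂]
  simp only at h
  rw [h]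

lemma IsCyclic.index_injective {A : Type*} [CommGroup A] [IsCyclic A] [Finite A] :
    Function.Injective fun K : Subgroup A ↦ K.index := by
  intro K₁ K₂ h
  refine IsCyclic.card_subgroup_injective (Nat.eq_of_mul_eq_mul_right
    (Nat.pos_of_ne_zero K₁.index_ne_zero_of_finite) ?_)
  simp only at h
  rw [K₁.card_mul_index, h, K₂.card_mul_index]

lemma Finset.sum_comp_le_sum_of_injective {ι κ : Type*} [Fintype ι] {g : ι → κ}
    (hg : Function.Injective g) (s : Finset κ) (hs : ∀ i, g i ∈ s) (f : κ → ℕ) :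
    ∑ i, f (g i) ≤ ∑ j ∈ s, f j := by
  refine (Finset.sum_map Finset.univ ⟨g, hg⟩ f).symm.trans_le ?_
  refine Finset.sum_le_sum_of_subset fun j hj ↦ ?_
  obtain ⟨i, -, rfl⟩ := Finset.mem_map.1 hj
  exact hs i

lemma IsCyclic.card_subgroup_prod_le {A B : Type*} [CommGroup A] [CommGroup B]
    [IsCyclic A] [IsCyclic B] [Finite A] [Finite B] :
    Nat.card (Subgroup (A × B)) ≤
      ∑ d ∈ (Nat.card A).divisors, ∑ e ∈ (Nat.card B).divisors, e.gcd d := by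
  classical
  have := Fintype.ofFinite (Subgroup A)
  have := Fintype.ofFinite (Subgroup B)
  rw [← Nat.card_congr (Equiv.sigmaFiberEquiv fun H : Subgroup (A × B) ↦
    (H.map (MonoidHom.fst A B), H.comap (MonoidHom.inr A B))), Nat.card_sigma,
    Fintype.sum_prod_type]
  calc
    _ ≤ ∑ K : Subgroup A, ∑ L : Subgroup B, L.index.gcd (Nat.card K) :=
      Finset.sum_le_sum fun K _ ↦ Finset.sum_le_sum fun L _ ↦
        Subgroup.card_map_fst_comap_inr_le K L
    _ ≤ ∑ K : Subgroup A, ∑ e ∈ (Nat.card B).divisors, e.gcd (Nat.card K) :=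
      Finset.sum_le_sum fun K _ ↦ Finset.sum_comp_le_sum_of_injective IsCyclic.index_injective _
        (fun L ↦ Nat.mem_divisors.2 ⟨L.index_dvd_card, Nat.card_pos.ne'⟩) fun e ↦ e.gcd (Nat.card K)
    _ ≤ _ := Finset.sum_comp_le_sum_of_injective IsCyclic.card_subgroup_injective _
        (fun K ↦ Nat.mem_divisors.2 ⟨K.card_subgroup_dvd_card, Nat.card_pos.ne'⟩)
        fun d ↦ ∑ e ∈ (Nat.card B).divisors, e.gcd d

/-- The number of subgroups of `ℤ/p^a × ℤ/p^b`, counted by the order `p ^ i` of the projection to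
the first factor and the index `p ^ j` of the intersection with the second one. -/
def subgroupCount (p a b : ℕ) : ℕ :=
  ∑ i ∈ Finset.range (a + 1), ∑ j ∈ Finset.range (b + 1), p ^ min i j

lemma card_subgroup_zmod_prod_le {p : ℕ} (hp : p.Prime) (a b : ℕ) :
    Nat.card (Subgroup (Multiplicative (ZMod (p ^ a)) × Multiplicative (ZMod (p ^ b)))) ≤
      subgroupCount p a b := by
  have : NeZero p := ⟨hp.ne_zero⟩
  refine (IsCyclic.card_subgroup_prod_le).trans_eq ?_
  simp only [Nat.card_eq_fintype_card, Fintype.card_multiplicative, ZMod.card,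
    Nat.sum_divisors_prime_pow hp, subgroupCount]
  refine Finset.sum_congr rfl fun i _ ↦ Finset.sum_congr rfl fun j _ ↦ ?_
  rcases le_total i j with h | h
  · rw [min_eq_left h, Nat.gcd_eq_right (pow_dvd_pow p h)]
  · rw [min_eq_right h, Nat.gcd_eq_left (pow_dvd_pow p h)]

lemma sum_range_pow_lt {p : ℕ} (hp : 2 ≤ p) (a : ℕ) :
    ∑ i ∈ Finset.range (a + 1), p ^ i < p ^ (a + 1) :=
  Nat.geomSum_lt hp fun _ hk ↦ Finset.mem_range.1 hk

lemma subgroupCount_succ_right {p a b : ℕ} (h : a ≤ b + 1) :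
    subgroupCount p a (b + 1) = subgroupCount p a b + ∑ i ∈ Finset.range (a + 1), p ^ i := by
  simp only [subgroupCount]
  rw [← Finset.sum_add_distrib]
  refine Finset.sum_congr rfl fun i hi ↦ ?_
  rw [Finset.sum_range_succ, min_eq_left (by have := Finset.mem_range.1 hi; omega)]

lemma subgroupCount_comm (p a b : ℕ) : subgroupCount p a b = subgroupCount p b a := by
  simp only [subgroupCount]
  rw [Finset.sum_comm]
  simp only [min_comm]

lemma subgroupCount_lt_of_succ_right {p a b : ℕ} (hp : 2 ≤ p) (h : a ≤ b) (hb : 1 ≤ b)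
    (hle : subgroupCount p a b ≤ p ^ (a + b)) : subgroupCount p a (b + 1) < p ^ (a + (b + 1)) := by
  rw [subgroupCount_succ_right (by omega)]
  have h₁ := sum_range_pow_lt hp a
  have h₂ : p ^ (a + 1) ≤ p ^ (a + b) := Nat.pow_le_pow_right (by omega) (by omega)
  have h₃ : 2 * p ^ (a + b) ≤ p ^ (a + (b + 1)) := by
    rw [← add_assoc, pow_succ']
    gcongr
  omega

lemma subgroupCount_self_lt {p a : ℕ} (hp : 2 ≤ p) (ha : 2 ≤ a) :
    subgroupCount p a a < p ^ (a + a) := by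
  induction a, ha using Nat.le_induction with
  | base =>
    have : subgroupCount p 2 2 = 5 + 3 * p + p ^ 2 := by
      simp [subgroupCount, Finset.sum_range_succ]
      ring
    rw [this]
    obtain ⟨q, rfl⟩ := Nat.exists_eq_add_of_le hp
    ring_nf
    nlinarith
  | succ a ha ih =>
    rw [subgroupCount_succ_right le_rfl, subgroupCount_comm, subgroupCount_succ_right (by omega),
      Finset.sum_range_succ _ (a + 1)]
    have h₁ := sum_range_pow_lt hp a
    have h₂ : p ^ (a + 1) ≤ p ^ (a + a) := Nat.pow_le_pow_right (by omega) (by omega)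
    have h₃ : 4 * p ^ (a + a) ≤ p ^ (a + 1 + (a + 1)) := by
      rw [show a + 1 + (a + 1) = 2 + (a + a) by ring, pow_add p 2]
      gcongr
      nlinarith
    omega

lemma subgroupCount_one_two (p : ℕ) : subgroupCount p 1 2 = 4 + 2 * p := by
  simp [subgroupCount, Finset.sum_range_succ]
  ring

lemma subgroupCount_one_two_le {p : ℕ} (hp : 2 ≤ p) : subgroupCount p 1 2 ≤ p ^ (1 + 2) := by
  obtain ⟨q, rfl⟩ := Nat.exists_eq_add_of_le hp
  rw [subgroupCount_one_two]
  ring_nf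
  nlinarith

lemma subgroupCount_lt {p a b : ℕ} (hp : 2 ≤ p) (ha : 1 ≤ a) (hab : a ≤ b) (hn : 3 ≤ a + b)
    (hne : ¬ (p = 2 ∧ a = 1 ∧ b = 2)) : subgroupCount p a b < p ^ (a + b) := by
  rcases ha.eq_or_lt with rfl | ha
  · induction b, (show 2 ≤ b by omega) using Nat.le_induction with
    | base =>
      obtain ⟨q, rfl⟩ := Nat.exists_eq_add_of_le (show 3 ≤ p by omega)
      rw [subgroupCount_one_two]
      ring_nf
      nlinarith
    | succ b hb ih =>
      refine subgroupCount_lt_of_succ_right hp (by omega) (by omega) ?_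
      rcases hb.eq_or_lt with rfl | hb
      · exact subgroupCount_one_two_le hp
      · exact (ih (by omega) (by omega) (by omega)).le
  · clear hne hn
    induction b, hab using Nat.le_induction with
    | base => exact subgroupCount_self_lt hp ha
    | succ b hb ih => exact subgroupCount_lt_of_succ_right hp hb (by omega) ih.le

/-- Eight subgroups of `ℤ/2 × ℤ/4`. -/
def subgroupsZModTwoFour : Fin 8 → Finset (ZMod 2 × ZMod 4) :=
  ![{(0, 0)}, {(0, 0), (0, 2)}, {(0, 0), (1, 0)}, {(0, 0), (1, 2)},
    {(0, 0), (0, 1), (0, 2), (0, 3)}, {(0, 0), (1, 1), (0, 2), (1, 3)},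
    {(0, 0), (1, 0), (0, 2), (1, 2)}, Finset.univ]

lemma eight_le_card_subgroup_zmod_two_four :
    8 ≤ Nat.card (Subgroup (Multiplicative (ZMod 2) × Multiplicative (ZMod 4))) := by
  let f : Fin 8 → Subgroup (Multiplicative (ZMod 2) × Multiplicative (ZMod 4)) := fun i ↦
    { carrier := {x | (x.1.toAdd, x.2.toAdd) ∈ subgroupsZModTwoFour i}
      mul_mem' := fun {x y} ↦ (by decide : ∀ i, ∀ x y : ZMod 2 × ZMod 4,
        x ∈ subgroupsZModTwoFour i → y ∈ subgroupsZModTwoFour i → x + y ∈ subgroupsZModTwoFour i)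
          i (x.1.toAdd, x.2.toAdd) (y.1.toAdd, y.2.toAdd)
      one_mem' := (by decide : ∀ i, (0 : ZMod 2 × ZMod 4) ∈ subgroupsZModTwoFour i) i
      inv_mem' := fun {x} ↦ (by decide : ∀ i, ∀ x : ZMod 2 × ZMod 4,
        x ∈ subgroupsZModTwoFour i → -x ∈ subgroupsZModTwoFour i) i (x.1.toAdd, x.2.toAdd) }
  have hf : Function.Injective f := fun i j hij ↦ by
    have hinj : Function.Injective subgroupsZModTwoFour := by decide
    refine hinj (Finset.ext fun x ↦ ?_)
    exact SetLike.ext_iff.1 hij (Multiplicative.ofAdd x.1, Multiplicative.ofAdd x.2)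
  simpa using Nat.card_le_card_of_injective f hf

lemma beta_congr {G H : Type*} [Group G] [Group H] (e : G ≃* H) : beta G = beta H := by
  rw [beta, beta, Nat.card_congr e.toEquiv, Nat.card_congr e.mapSubgroup.toEquiv]

lemma beta_zmod_two_four : beta (Multiplicative (ZMod 2) × Multiplicative (ZMod 4)) = 1 := by
  have hle : Nat.card (Subgroup (Multiplicative (ZMod 2) × Multiplicative (ZMod 4))) ≤ 8 :=
    card_subgroup_zmod_prod_le Nat.prime_two 1 2
  rw [beta, hle.antisymm eight_le_card_subgroup_zmod_two_four]
  norm_num [Nat.card_prod, Nat.card_eq_fintype_card, ZMod.card]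

theorem stmt_16 (p n d1 d2 : ℕ) (hp : p.Prime) (hn : 3 ≤ n)
    (h1 : 1 ≤ d1) (h12 : d1 ≤ d2) (hsum : d1 + d2 = n)
    (G : Type) [CommGroup G]
    (hG : Nonempty (G ≃* Multiplicative (ZMod (p ^ d1)) × Multiplicative (ZMod (p ^ d2)))) :
    beta G ≤ 1 ∧
    (beta G = 1 ↔ Nonempty (G ≃* Multiplicative (ZMod 2) × Multiplicative (ZMod 4))) := by
  obtain ⟨e⟩ := hG
  by_cases h : p = 2 ∧ d1 = 1 ∧ d2 = 2
  · obtain ⟨rfl, rfl, rfl⟩ := h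
    have hb : beta G = 1 := (beta_congr e).trans beta_zmod_two_four
    exact ⟨hb.le, fun _ ↦ ⟨e⟩, fun _ ↦ hb⟩
  · have hlt : beta G < 1 := by
      have : NeZero p := ⟨hp.ne_zero⟩
      have hcard : Nat.card (Multiplicative (ZMod (p ^ d1)) × Multiplicative (ZMod (p ^ d2))) =
          p ^ (d1 + d2) := by
        simp [Nat.card_eq_fintype_card, ZMod.card, pow_add]
      rw [beta_congr e, beta, hcard, div_lt_one (by exact_mod_cast pow_pos hp.pos _)]
      exact_mod_cast (card_subgroup_zmod_prod_le hp d1 d2).trans_lt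
        (subgroupCount_lt hp.two_le h1 h12 (hsum ▸ hn) h)
    exact ⟨hlt.le, fun h ↦ absurd h hlt.ne, fun ⟨e'⟩ ↦
      (beta_congr e').trans beta_zmod_two_four⟩
end
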